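/- Let p > 0 be a real number and let ψ : ℝ → ℝ be a smooth compactly supported function. Then lim_{t→∞} (log t)^{1/p} · L(t;ψ) = ψ(0). -/

import Mathlib

open MeasureTheory Filter

/-- `L(t;ψ) = ∫₀^∞ e^{i t exp(-1/x^p)} ψ(x) dx`. -/
noncomputable def Lfull (p t : ℝ) (ψ : ℝ → ℝ) : ℂ :=
  ∫ x in Set.Ioi (0 : ℝ),
    Complex.exp (Complex.I * (t : ℂ) * ((Real.exp (-1 / x ^ p) : ℝ) : ℂ)) * ((ψ x : ℝ) : ℂ)

/-- The rescaled integrand: the integrand of `Lfull p (exp T) ψ` at `x = s * y`,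
where `s ^ p = 1 / T`. -/
noncomputable def rescaledIntegrand (p T s : ℝ) (ψ : ℝ → ℝ) (y : ℝ) : ℂ :=
  Complex.exp (Complex.I * ((Real.exp (T - T / y ^ p) : ℝ) : ℂ)) * ((ψ (s * y) : ℝ) : ℂ)

/-- The amplitude divided by the derivative of the rescaled phase. -/
noncomputable def reducedAmplitude (p T s : ℝ) (ψ : ℝ → ℝ) (y : ℝ) : ℝ :=
  ψ (s * y) * (y * y ^ p) * Real.exp (T / y ^ p - T) / (T * p)

/-- The derivative of `reducedAmplitude`. -/
noncomputable def reducedAmplitudeDeriv (p T s : ℝ) (ψ : ℝ → ℝ) (y : ℝ) : ℝ :=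
  (deriv ψ (s * y) * (s * y) * (y ^ p / T) / p + ψ (s * y) * (p + 1) * (y ^ p / T) / p
    - ψ (s * y)) * Real.exp (T / y ^ p - T)

/-- The remainder of the integration by parts. -/
noncomputable def partsRemainder (p T s : ℝ) (ψ : ℝ → ℝ) (y : ℝ) : ℂ :=
  Complex.exp (Complex.I * ((Real.exp (T - T / y ^ p) : ℝ) : ℂ)) *
    (-Complex.I * ((reducedAmplitudeDeriv p T s ψ y : ℝ) : ℂ))

lemma norm_cexp_I_mul_ofReal (r : ℝ) : ‖Complex.exp (Complex.I * (r : ℂ))‖ = 1 := by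
  rw [mul_comm]; exact Complex.norm_exp_ofReal_mul_I r

lemma norm_rescaledIntegrand (p T s : ℝ) (ψ : ℝ → ℝ) (y : ℝ) :
    ‖rescaledIntegrand p T s ψ y‖ = |ψ (s * y)| := by
  rw [rescaledIntegrand, norm_mul, norm_cexp_I_mul_ofReal, one_mul, Complex.norm_real,
    Real.norm_eq_abs]

lemma norm_partsRemainder (p T s : ℝ) (ψ : ℝ → ℝ) (y : ℝ) :
    ‖partsRemainder p T s ψ y‖ = |reducedAmplitudeDeriv p T s ψ y| := by
  rw [partsRemainder, norm_mul, norm_cexp_I_mul_ofReal, one_mul, norm_mul, norm_neg,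
    Complex.norm_I, one_mul, Complex.norm_real, Real.norm_eq_abs]

lemma measurable_rescaledIntegrand (p T s : ℝ) {ψ : ℝ → ℝ} (hψ : Continuous ψ) :
    Measurable (rescaledIntegrand p T s ψ) := by
  have := hψ.measurable
  unfold rescaledIntegrand
  fun_prop

lemma measurable_partsRemainder (p T s : ℝ) {ψ : ℝ → ℝ} (hψ : Continuous ψ) :
    Measurable (partsRemainder p T s ψ) := by
  have := hψ.measurable
  have := measurable_deriv ψ
  unfold partsRemainder reducedAmplitudeDeriv
  fun_prop

lemma hasDerivAt_div_rpow {p y : ℝ} (T : ℝ) (hy : 0 < y) :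
    HasDerivAt (fun y : ℝ => T / y ^ p) (-(T * p / (y * y ^ p))) y := by
  have h0 : y ^ p ≠ 0 := (Real.rpow_pos_of_pos hy p).ne'
  have h1 := (Real.hasDerivAt_rpow_const (p := p) (Or.inl hy.ne'))
  have h2 := (hasDerivAt_const y T).div h1 h0
  refine h2.congr_deriv ?_
  rw [Real.rpow_sub_one hy.ne']
  have := hy.ne'
  field_simp
  ring

lemma hasDerivAt_reducedAmplitude {p T y : ℝ} (s : ℝ) {ψ : ℝ → ℝ} (hp : p ≠ 0) (hT : T ≠ 0)
    (hψ : Differentiable ℝ ψ) (hy : 0 < y) :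
    HasDerivAt (reducedAmplitude p T s ψ) (reducedAmplitudeDeriv p T s ψ y) y := by
  have h0 : y ^ p ≠ 0 := (Real.rpow_pos_of_pos hy p).ne'
  have h1 := (Real.hasDerivAt_rpow_const (p := p) (Or.inl hy.ne'))
  have h2 : HasDerivAt (fun y => ψ (s * y)) (deriv ψ (s * y) * s) y := by
    have h := ((hψ (s * y)).hasDerivAt).comp y ((hasDerivAt_id y).const_mul s)
    exact h.congr_deriv (by rw [mul_one])
  have h3 := ((hasDerivAt_div_rpow (p := p) T hy).sub_const T).exp
  have h4 := ((h2.mul ((hasDerivAt_id y).mul h1)).mul h3).div_const (T * p)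
  refine h4.congr_deriv ?_
  simp only [reducedAmplitudeDeriv, id, Real.rpow_sub_one hy.ne', Pi.mul_apply]
  have := hy.ne'
  field_simp
  ring

lemma hasDerivAt_cexp_mul_reducedAmplitude {p T y : ℝ} (s : ℝ) {ψ : ℝ → ℝ} (hp : p ≠ 0)
    (hT : T ≠ 0) (hψ : Differentiable ℝ ψ) (hy : 0 < y) :
    HasDerivAt (fun y : ℝ => Complex.exp (Complex.I * ((Real.exp (T - T / y ^ p) : ℝ) : ℂ)) *
        (-Complex.I * ((reducedAmplitude p T s ψ y : ℝ) : ℂ)))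
      (rescaledIntegrand p T s ψ y + partsRemainder p T s ψ y) y := by
  have h0 : y ^ p ≠ 0 := (Real.rpow_pos_of_pos hy p).ne'
  have h1 := ((hasDerivAt_div_rpow (p := p) T hy).const_sub T).exp.ofReal_comp
  have h2 := (hasDerivAt_reducedAmplitude s hp hT hψ hy).ofReal_comp
  have h3 := (h1.const_mul Complex.I).cexp.mul (h2.const_mul (-Complex.I))
  refine h3.congr_deriv ?_
  rw [rescaledIntegrand, partsRemainder]
  congr 1
  have h4 : Real.exp (T - T / y ^ p) * - -(T * p / (y * y ^ p)) * reducedAmplitude p T s ψ y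
      = ψ (s * y) := by
    have h5 : Real.exp (T / y ^ p - T) = (Real.exp (T - T / y ^ p))⁻¹ := by
      rw [← Real.exp_neg]; congr 1; ring
    rw [reducedAmplitude, h5]
    have := Real.exp_ne_zero (T - T / y ^ p)
    have := hy.ne'
    field_simp
  rw [← h4]
  push_cast
  linear_combination (-(Complex.exp (Complex.I * Complex.exp (T - T / ((y ^ p : ℝ) : ℂ))) *
    Complex.exp (T - T / ((y ^ p : ℝ) : ℂ)) * (T * p / (y * ((y ^ p : ℝ) : ℂ))) *
    (reducedAmplitude p T s ψ y : ℂ))) * Complex.I_sq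

lemma abs_reducedAmplitudeDeriv_le {p T s M C y : ℝ} {ψ : ℝ → ℝ} (hp : 0 < p) (hT : 0 < T)
    (hs : 0 < s) (hsT : s ^ p = 1 / T) (hM : 0 < M) (hψM : ∀ x, M < x → ψ x = 0)
    (hψM' : ∀ x, M < x → deriv ψ x = 0)
    (hC : ∀ x, |ψ x| ≤ C) (hC' : ∀ x, |deriv ψ x| ≤ C) (hy : 1 < y) :
    |reducedAmplitudeDeriv p T s ψ y| ≤
        (C * M * M ^ p / p + C * (p + 1) * M ^ p / p + C) * Real.exp (T / y ^ p - T) ∧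
      |reducedAmplitudeDeriv p T s ψ y| ≤
        (C * M * M ^ p / p + C * (p + 1) * M ^ p / p + C) *
          (Real.exp (1 / M ^ p) * Real.exp (-(1 / M ^ p) * y ^ p)) := by
  have hy0 : 0 < y := by linarith
  have hyp : 0 < y ^ p := Real.rpow_pos_of_pos hy0 p
  have hMp : 0 < M ^ p := Real.rpow_pos_of_pos hM p
  have hC0 : 0 ≤ C := (abs_nonneg _).trans (hC 0)
  have hK : 0 ≤ C * M * M ^ p / p + C * (p + 1) * M ^ p / p + C := by positivity
  rcases lt_or_ge M (s * y) with h | h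
  · have : reducedAmplitudeDeriv p T s ψ y = 0 := by
      simp [reducedAmplitudeDeriv, hψM _ h, hψM' _ h]
    rw [this, abs_zero]
    constructor <;> positivity
  have hsy : 0 < s * y := by positivity
  have h1 : y ^ p / T ≤ M ^ p := by
    have := Real.rpow_le_rpow hsy.le h hp.le
    rwa [Real.mul_rpow hs.le hy0.le, hsT, one_div_mul_eq_div] at this
  have h2 : |reducedAmplitudeDeriv p T s ψ y| ≤
        (C * M * M ^ p / p + C * (p + 1) * M ^ p / p + C) * Real.exp (T / y ^ p - T) := by
    rw [reducedAmplitudeDeriv, abs_mul, abs_of_pos (Real.exp_pos _)]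
    gcongr
    refine (abs_sub _ _).trans (add_le_add ((abs_add_le _ _).trans (add_le_add ?_ ?_)) (hC _))
    · rw [abs_div, abs_mul, abs_mul, abs_of_pos hsy, abs_of_pos hp,
        abs_of_pos (show 0 < y ^ p / T by positivity)]
      gcongr
      exact hC' _
    · rw [abs_div, abs_mul, abs_mul, abs_of_pos hp, abs_of_pos (show 0 < p + 1 by positivity),
        abs_of_pos (show 0 < y ^ p / T by positivity)]
      gcongr
      exact hC _
  refine ⟨h2, h2.trans (mul_le_mul_of_nonneg_left ?_ hK)⟩
  rw [← Real.exp_add, Real.exp_le_exp]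
  have h3 : 1 ≤ y ^ p := Real.one_le_rpow hy.le hp.le
  have h4 : y ^ p / M ^ p ≤ T := by
    rw [div_le_iff₀ hMp]; rwa [div_le_iff₀ hT, mul_comm] at h1
  have h5 : (y ^ p / M ^ p) * (1 - 1 / y ^ p) ≤ T * (1 - 1 / y ^ p) := by
    refine mul_le_mul_of_nonneg_right h4 ?_
    rw [sub_nonneg, div_le_one hyp]; exact h3
  have h6 : (y ^ p / M ^ p) * (1 - 1 / y ^ p) = -(1 / M ^ p + -(1 / M ^ p) * y ^ p) := by
    field_simp
    ring
  have h7 : T * (1 - 1 / y ^ p) = -(T / y ^ p - T) := by ring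
  linarith

lemma integrableOn_exp_neg_mul_rpow {p b : ℝ} (hp : 0 < p) (hb : 0 < b) :
    IntegrableOn (fun y : ℝ => Real.exp (-b * y ^ p)) (Set.Ioi 0) := by
  have h := integrableOn_rpow_mul_exp_neg_mul_rpow (s := 0) (by norm_num) hp hb
  simpa using h

lemma tendsto_rescaled_exponent {p y : ℝ} (hp : 0 < p) (hy : 1 < y) :
    Tendsto (fun T : ℝ => T / y ^ p - T) atTop atBot := by
  have h3 : 1 < y ^ p := Real.one_lt_rpow hy hp
  have h : (y ^ p)⁻¹ - 1 < 0 := by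
    rw [sub_neg]; exact inv_lt_one_of_one_lt₀ h3
  refine (tendsto_id.const_mul_atTop_of_neg h).congr fun T => ?_
  simp only [id]; ring

lemma tendsto_rescaled_exponent_of_lt_one {p y : ℝ} (hp : 0 < p) (hy0 : 0 < y) (hy : y < 1) :
    Tendsto (fun T : ℝ => T - T / y ^ p) atTop atBot := by
  have h3 : y ^ p < 1 := Real.rpow_lt_one hy0.le hy hp
  have h : 1 - (y ^ p)⁻¹ < 0 := by
    rw [sub_neg]; exact (one_lt_inv₀ (Real.rpow_pos_of_pos hy0 p)).2 h3
  refine (tendsto_id.const_mul_atTop_of_neg h).congr fun T => ?_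
  simp only [id]; ring

lemma tendsto_integral_rescaledIntegrand_Ioc {p C : ℝ} {s : ℝ → ℝ} {ψ : ℝ → ℝ} (hp : 0 < p)
    (hs : Tendsto s atTop (nhds 0)) (hψ : Continuous ψ) (hC : ∀ x, |ψ x| ≤ C) :
    Tendsto (fun T => ∫ y in Set.Ioc (0 : ℝ) 1, rescaledIntegrand p T (s T) ψ y) atTop
      (nhds ((ψ 0 : ℝ) : ℂ)) := by
  have key : Tendsto (fun T => ∫ y in Set.Ioc (0 : ℝ) 1, rescaledIntegrand p T (s T) ψ y) atTop
      (nhds (∫ _ in Set.Ioc (0 : ℝ) 1, ((ψ 0 : ℝ) : ℂ))) := by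
    refine tendsto_integral_filter_of_dominated_convergence (fun _ => C) ?_ ?_ ?_ ?_
    · exact Eventually.of_forall fun T =>
        (measurable_rescaledIntegrand p T (s T) hψ).aestronglyMeasurable
    · exact Eventually.of_forall fun T => Eventually.of_forall fun y => by
        rw [norm_rescaledIntegrand]; exact hC _
    · exact integrableOn_const (by simp)
    · have hne : ∀ᵐ y : ℝ ∂(volume.restrict (Set.Ioc 0 1)), y ≠ 1 :=
        ae_restrict_of_ae (by simp [ae_iff])
      filter_upwards [hne, ae_restrict_mem measurableSet_Ioc] with y hy1 hy
      have h1 := Real.tendsto_exp_atBot.comp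
        (tendsto_rescaled_exponent_of_lt_one hp hy.1 (lt_of_le_of_ne hy.2 hy1))
      have h2 : Tendsto (fun T => ψ (s T * y)) atTop (nhds (ψ (0 * y))) :=
        (hψ.tendsto _).comp (hs.mul_const y)
      rw [zero_mul] at h2
      have h3 := (Complex.continuous_ofReal.tendsto _).comp h1
      have h4 := (Complex.continuous_exp.tendsto _).comp (h3.const_mul Complex.I)
      have h5 := h4.mul ((Complex.continuous_ofReal.tendsto _).comp h2)
      simpa [rescaledIntegrand, Function.comp_def] using h5
  simpa using key

lemma integrableOn_rescaledIntegrand (p T : ℝ) {s : ℝ} {ψ : ℝ → ℝ} (hs : 0 < s)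
    (hψ : Continuous ψ) (hψc : HasCompactSupport ψ) (S : Set ℝ) :
    IntegrableOn (rescaledIntegrand p T s ψ) S := by
  have h := (hψ.integrable_of_hasCompactSupport hψc).comp_mul_left' hs.ne'
  refine Integrable.mono' (h.norm.integrableOn (s := S))
    (measurable_rescaledIntegrand p T s hψ).aestronglyMeasurable
    (Eventually.of_forall fun y => ?_)
  rw [norm_rescaledIntegrand, Real.norm_eq_abs]

lemma tendsto_integral_rescaledIntegrand_Ioi {p M C : ℝ} {s : ℝ → ℝ} {ψ : ℝ → ℝ} (hp : 0 < p)
    (hs0 : ∀ T, 0 < T → 0 < s T) (hsT : ∀ T, 0 < T → s T ^ p = 1 / T)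
    (hψ : Differentiable ℝ ψ) (hψc : HasCompactSupport ψ) (hM : 0 < M)
    (hψM : ∀ x, M < x → ψ x = 0) (hψM' : ∀ x, M < x → deriv ψ x = 0)
    (hC : ∀ x, |ψ x| ≤ C) (hC' : ∀ x, |deriv ψ x| ≤ C) :
    Tendsto (fun T => ∫ y in Set.Ioi (1 : ℝ), rescaledIntegrand p T (s T) ψ y) atTop
      (nhds 0) := by
  have hbound := fun {T y : ℝ} (hT : 0 < T) (hy : 1 < y) => abs_reducedAmplitudeDeriv_le hp hT
    (hs0 T hT) (hsT T hT) hM hψM hψM' hC hC' hy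
  set K := C * M * M ^ p / p + C * (p + 1) * M ^ p / p + C
  have hMp : 0 < 1 / M ^ p := one_div_pos.2 (Real.rpow_pos_of_pos hM p)
  have hint : IntegrableOn (fun y : ℝ => K * (Real.exp (1 / M ^ p) *
      Real.exp (-(1 / M ^ p) * y ^ p))) (Set.Ioi 1) :=
    (((integrableOn_exp_neg_mul_rpow hp hMp).mono_set
      (Set.Ioi_subset_Ioi zero_le_one)).const_mul _).const_mul _
  have hrem : Tendsto (fun T => ∫ y in Set.Ioi (1 : ℝ), partsRemainder p T (s T) ψ y) atTop
      (nhds 0) := by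
    have key : Tendsto (fun T => ∫ y in Set.Ioi (1 : ℝ), partsRemainder p T (s T) ψ y) atTop
        (nhds (∫ _ in Set.Ioi (1 : ℝ), (0 : ℂ))) := by
      refine tendsto_integral_filter_of_dominated_convergence _ ?_ ?_ hint ?_
      · exact Eventually.of_forall fun T =>
          (measurable_partsRemainder p T (s T) hψ.continuous).aestronglyMeasurable
      · filter_upwards [eventually_gt_atTop 0] with T hT
        filter_upwards [ae_restrict_mem measurableSet_Ioi] with y hy
        rw [norm_partsRemainder]
        exact (hbound hT hy).2
      · filter_upwards [ae_restrict_mem measurableSet_Ioi] with y hy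
        have h := (Real.tendsto_exp_atBot.comp (tendsto_rescaled_exponent hp hy)).const_mul K
        rw [mul_zero] at h
        refine squeeze_zero_norm' ?_ h
        filter_upwards [eventually_gt_atTop 0] with T hT
        rw [norm_partsRemainder]
        exact (hbound hT hy).1
    simpa using key
  have hbdry : Tendsto (fun T => Complex.exp (Complex.I * ((Real.exp (T - T / 1 ^ p) : ℝ) : ℂ)) *
        (-Complex.I * ((reducedAmplitude p T (s T) ψ 1 : ℝ) : ℂ))) atTop (nhds 0) := by
    have h : Tendsto (fun T : ℝ => C / p * T⁻¹) atTop (nhds 0) := by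
      simpa using tendsto_inv_atTop_zero.const_mul (C / p)
    refine squeeze_zero_norm' ?_ h
    filter_upwards [eventually_gt_atTop 0] with T hT
    rw [norm_mul, norm_cexp_I_mul_ofReal, one_mul, norm_mul, norm_neg, Complex.norm_I, one_mul,
      Complex.norm_real, Real.norm_eq_abs, reducedAmplitude]
    simp only [Real.one_rpow, mul_one, div_one, sub_self, Real.exp_zero]
    rw [abs_div, abs_of_pos (mul_pos hT hp), div_mul_eq_mul_div, mul_comm T p, ← div_div,
      div_eq_mul_inv _ T, div_mul_eq_mul_div]
    gcongr
    exact hC _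
  have hsum := (hrem.neg).sub hbdry
  rw [neg_zero, sub_zero] at hsum
  refine hsum.congr' ?_
  filter_upwards [eventually_gt_atTop 0] with T hT
  have hG := integrableOn_rescaledIntegrand p T (hs0 T hT) hψ.continuous hψc (Set.Ioi 1)
  have hE : IntegrableOn (partsRemainder p T (s T) ψ) (Set.Ioi 1) := by
    refine Integrable.mono' hint
      (measurable_partsRemainder p T (s T) hψ.continuous).aestronglyMeasurable ?_
    filter_upwards [ae_restrict_mem measurableSet_Ioi] with y hy
    rw [norm_partsRemainder]
    exact (hbound hT hy).2
  have hF := integral_Ioi_of_hasDerivAt_of_tendsto' (a := 1) (m := 0)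
    (f := fun y : ℝ => Complex.exp (Complex.I * ((Real.exp (T - T / y ^ p) : ℝ) : ℂ)) *
        (-Complex.I * ((reducedAmplitude p T (s T) ψ y : ℝ) : ℂ)))
    (fun y hy => hasDerivAt_cexp_mul_reducedAmplitude (s T) hp.ne' hT.ne' hψ
      (zero_lt_one.trans_le hy)) (hG.add hE) (by
        refine tendsto_const_nhds.congr' ?_
        filter_upwards [eventually_gt_atTop (M / s T)] with y hy
        rw [div_lt_iff₀' (hs0 T hT)] at hy
        simp [reducedAmplitude, hψM _ hy])
  rw [integral_add hG hE] at hF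
  linear_combination -hF

lemma rpow_mul_Lfull {p t : ℝ} (ψ : ℝ → ℝ) (hp : 0 < p) (ht : 1 < t) :
    (((Real.log t) ^ (1 / p) : ℝ) : ℂ) * Lfull p t ψ =
      ∫ y in Set.Ioi (0 : ℝ),
        rescaledIntegrand p (Real.log t) (Real.log t ^ (-(1 / p))) ψ y := by
  have hT : 0 < Real.log t := Real.log_pos ht
  have hs : 0 < Real.log t ^ (-(1 / p)) := Real.rpow_pos_of_pos hT _
  have h := integral_comp_mul_left_Ioi (fun x : ℝ =>
    Complex.exp (Complex.I * (t : ℂ) * ((Real.exp (-1 / x ^ p) : ℝ) : ℂ)) * ((ψ x : ℝ) : ℂ))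
    0 hs
  rw [mul_zero, Real.rpow_neg hT.le, inv_inv, Complex.real_smul] at h
  rw [Lfull, ← h, Real.rpow_neg hT.le]
  refine setIntegral_congr_fun measurableSet_Ioi fun y hy => ?_
  have hy0 : (0 : ℝ) < y := hy
  have hpow : ((Real.log t ^ (1 / p))⁻¹ * y) ^ p = y ^ p / Real.log t := by
    rw [Real.mul_rpow (by positivity) hy0.le, Real.inv_rpow (by positivity), ← Real.rpow_mul hT.le,
      one_div_mul_cancel hp.ne', Real.rpow_one, inv_mul_eq_div]
  have hexp : t * Real.exp (-1 / (y ^ p / Real.log t)) =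
      Real.exp (Real.log t - Real.log t / y ^ p) := by
    rw [sub_eq_add_neg, Real.exp_add, Real.exp_log (by linarith)]
    congr 2
    rw [div_div_eq_mul_div, neg_one_mul, neg_div]
  simp only [rescaledIntegrand]
  rw [hpow, ← hexp, mul_assoc Complex.I]
  push_cast
  rfl

theorem stmt5 (p : ℝ) (hp : 0 < p) (ψ : ℝ → ℝ)
    (hψ : ContDiff ℝ (⊤ : ℕ∞) ψ) (hψc : HasCompactSupport ψ) :
    Tendsto (fun t : ℝ => (((Real.log t) ^ (1 / p) : ℝ) : ℂ) * Lfull p t ψ)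
      atTop (nhds ((ψ 0 : ℝ) : ℂ)) := by
  have hd : Differentiable ℝ ψ := hψ.differentiable (by simp)
  have hcd : Continuous (deriv ψ) := hψ.continuous_deriv (by simp)
  obtain ⟨C₁, hC₁⟩ := hψ.continuous.bounded_above_of_compact_support hψc
  obtain ⟨C₂, hC₂⟩ := hcd.bounded_above_of_compact_support hψc.deriv
  obtain ⟨M, hM, hsupp⟩ := hψc.isCompact.isBounded.exists_pos_norm_le
  have hnot : ∀ x, M < x → x ∉ tsupport ψ := fun x hx hmem =>
    absurd ((le_abs_self x).trans (hsupp x hmem)) (not_le.2 hx)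
  have hs : Tendsto (fun T : ℝ => T ^ (-(1 / p))) atTop (nhds 0) :=
    tendsto_rpow_neg_atTop (one_div_pos.2 hp)
  have hs0 : ∀ T : ℝ, 0 < T → 0 < T ^ (-(1 / p)) := fun T hT => Real.rpow_pos_of_pos hT _
  have hnear := tendsto_integral_rescaledIntegrand_Ioc hp hs hψ.continuous hC₁
  have hfar := tendsto_integral_rescaledIntegrand_Ioi (C := max C₁ C₂) hp hs0
    (fun T hT => by
      rw [← Real.rpow_mul hT.le, neg_mul, one_div_mul_cancel hp.ne', Real.rpow_neg_one, one_div])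
    hd hψc hM (fun x hx => image_eq_zero_of_notMem_tsupport (hnot x hx))
    (fun x hx => Function.notMem_support.1 fun h => hnot x hx (support_deriv_subset h))
    (fun x => (hC₁ x).trans (le_max_left _ _)) (fun x => (hC₂ x).trans (le_max_right _ _))
  have hsum := (hnear.add hfar).comp Real.tendsto_log_atTop
  rw [add_zero] at hsum
  refine hsum.congr' ?_
  filter_upwards [eventually_gt_atTop 1] with t ht
  have hlog := hs0 _ (Real.log_pos ht)
  rw [rpow_mul_Lfull ψ hp ht, ← Set.Ioc_union_Ioi_eq_Ioi (zero_le_one (α := ℝ)),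
    setIntegral_union Set.Ioc_disjoint_Ioi_same measurableSet_Ioi
      (integrableOn_rescaledIntegrand p _ hlog hψ.continuous hψc _)
      (integrableOn_rescaledIntegrand p _ hlog hψ.continuous hψc _)]
  rfl
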